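/- If u ∈ Ḣ¹(ℝ⁴) satisfies ‖∇u‖²_{L²} ≤ (1−δ̄)‖∇W‖²_{L²} for some δ̄ > 0, then ∫(|∇u|² − |u|⁴)dx ≥ δ̄∫|∇u|² dx, where the sharp Sobolev constant is ‖W‖_{L⁴}/‖∇W‖_{L²} = ‖∇W‖_{L²}^{−1/2}. -/

import Mathlib

open MeasureTheory

/-- The ground state `W(x) = (1 + |x|²/8)⁻¹` on `ℝ⁴`. -/
noncomputable def W (x : EuclideanSpace ℝ (Fin 4)) : ℝ := (1 + ‖x‖ ^ 2 / 8)⁻¹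

namespace Knothe


/-- Prepend a coordinate. -/
def cns {n : ℕ} (t : ℝ) (y : Fin n → ℝ) : Fin (n + 1) → ℝ := Fin.cons t y

/-- Drop the first coordinate. -/
def tl {n : ℕ} (x : Fin (n + 1) → ℝ) : Fin n → ℝ := fun i => x i.succ

@[simp] lemma cns_zero {n : ℕ} (t : ℝ) (y : Fin n → ℝ) : cns t y 0 = t := rfl
@[simp] lemma cns_succ {n : ℕ} (t : ℝ) (y : Fin n → ℝ) (i : Fin n) : cns t y i.succ = y i := rfl
@[simp] lemma tl_cns {n : ℕ} (t : ℝ) (y : Fin n → ℝ) : tl (cns t y) = y := rfl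
@[simp] lemma cns_tl {n : ℕ} (x : Fin (n + 1) → ℝ) : cns (x 0) (tl x) = x := by
  funext i
  refine Fin.cases rfl (fun j => rfl) i

lemma continuous_cns {n : ℕ} : Continuous (fun p : ℝ × (Fin n → ℝ) => cns p.1 p.2) := by
  refine continuous_pi fun i => ?_
  refine Fin.cases ?_ (fun j => ?_) i
  · simpa using continuous_fst
  · simp only [cns_succ]; fun_prop

lemma continuous_tl {n : ℕ} : Continuous (tl : (Fin (n + 1) → ℝ) → _) := by
  unfold tl; fun_prop

lemma Continuous.cns' {X : Type*} [TopologicalSpace X] {n : ℕ} {f : X → ℝ} {g : X → Fin n → ℝ}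
    (hf : Continuous f) (hg : Continuous g) : Continuous (fun x => cns (f x) (g x)) :=
  continuous_cns.comp (hf.prodMk hg)

lemma mp_insertNth {n : ℕ} (i : Fin (n + 1)) :
    MeasurePreserving (fun p : ℝ × (Fin n → ℝ) => (i.insertNth p.1 p.2 : Fin (n + 1) → ℝ))
      (volume.prod volume) volume :=
  (volume_preserving_piFinSuccAbove (fun _ : Fin (n + 1) => ℝ) i).symm

lemma me_insertNth {n : ℕ} (i : Fin (n + 1)) :
    MeasurableEmbedding (fun p : ℝ × (Fin n → ℝ) => (i.insertNth p.1 p.2 : Fin (n + 1) → ℝ)) :=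
  (MeasurableEquiv.piFinSuccAbove (fun _ : Fin (n + 1) => ℝ) i).symm.measurableEmbedding

lemma integrable_insertNth {n : ℕ} (i : Fin (n + 1)) (k : (Fin (n + 1) → ℝ) → ℝ) :
    Integrable (fun p : ℝ × (Fin n → ℝ) => k (i.insertNth p.1 p.2)) (volume.prod volume)
      ↔ Integrable k :=
  (mp_insertNth i).integrable_comp_emb (me_insertNth i)

lemma integral_insertNth {n : ℕ} (i : Fin (n + 1)) {k : (Fin (n + 1) → ℝ) → ℝ}
    (hk : Integrable k) :
    ∫ x, k x = ∫ y : Fin n → ℝ, ∫ t : ℝ, k (i.insertNth t y) := by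
  rw [← (mp_insertNth i).integral_comp (me_insertNth i)]
  exact integral_prod_symm _ ((integrable_insertNth i k).2 hk)

lemma integral_cns {n : ℕ} {k : (Fin (n + 1) → ℝ) → ℝ} (hk : Integrable k) :
    ∫ x, k x = ∫ y : Fin n → ℝ, ∫ t : ℝ, k (cns t y) := by
  rw [integral_insertNth 0 hk]
  simp only [Fin.insertNth_zero]
  rfl

lemma hasDerivAt_of_comp_eq {H Φ τ : ℝ → ℝ} {h φ t₀ : ℝ} (hH : HasStrictDerivAt H h (τ t₀))
    (h0 : h ≠ 0) (hτ : ContinuousAt τ t₀) (he : ∀ t, H (τ t) = Φ t) (hΦ : HasDerivAt Φ φ t₀) :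
    HasDerivAt τ (φ / h) t₀ := by
  have h1 := (hH.to_localInverse h0).hasDerivAt
  rw [he t₀] at h1
  have h2 := h1.comp t₀ hΦ
  have h3 : ∀ᶠ t in nhds t₀, τ t = (HasStrictDerivAt.localInverse H h (τ t₀) hH h0 ∘ Φ) t := by
    filter_upwards [hτ.eventually (hH.eventually_left_inverse h0)] with t ht
    simp only [Function.comp, ← he t]
    exact ht.symm
  rw [div_eq_inv_mul]
  exact h2.congr_of_eventuallyEq h3

/-- The cube. -/
def Q (n : ℕ) (R : ℝ) : Set (Fin n → ℝ) := {x | ∀ i, |x i| ≤ R}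

lemma isCompact_Q (n : ℕ) (R : ℝ) : IsCompact (Q n R) := by
  have : Q n R = Set.Icc (fun _ => -R) (fun _ => R) := by
    ext x; simp [Q, Set.mem_Icc, Pi.le_def, abs_le, forall_and]
  rw [this]; exact isCompact_Icc

lemma measurableSet_Q (n : ℕ) (R : ℝ) : MeasurableSet (Q n R) := (isCompact_Q n R).measurableSet

lemma cns_mem_Q {n : ℕ} {R t : ℝ} {y : Fin n → ℝ} : cns t y ∈ Q (n+1) R ↔ |t| ≤ R ∧ y ∈ Q n R := by
  simp [Q, Fin.forall_fin_succ]

lemma integral_Q {n : ℕ} {R : ℝ} (hR : 0 < R) {k : (Fin (n + 1) → ℝ) → ℝ} (hk : Continuous k) :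
    ∫ x in Q (n+1) R, k x = ∫ y in Q n R, ∫ t in (-R)..R, k (cns t y) := by
  rw [← integral_indicator (measurableSet_Q _ _), ← integral_indicator (measurableSet_Q _ _),
    integral_cns]
  · congr 1; funext y
    by_cases hy : y ∈ Q n R
    · rw [Set.indicator_of_mem hy, intervalIntegral.integral_of_le (by linarith),
        ← integral_Icc_eq_integral_Ioc, ← integral_indicator measurableSet_Icc]
      congr 1; funext t
      by_cases ht : |t| ≤ R
      · rw [Set.indicator_of_mem (cns_mem_Q.2 ⟨ht, hy⟩), Set.indicator_of_mem]
        exact abs_le.1 ht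
      · rw [Set.indicator_of_notMem (fun h => ht (cns_mem_Q.1 h).1), Set.indicator_of_notMem]
        exact fun h => ht (abs_le.2 h)
    · rw [Set.indicator_of_notMem hy]
      convert integral_zero ℝ ℝ with t
      rw [Set.indicator_of_notMem (fun h => hy (cns_mem_Q.1 h).2)]
  · rw [integrable_indicator_iff (measurableSet_Q _ _)]
    exact hk.continuousOn.integrableOn_compact (isCompact_Q _ _)

lemma integral_supp {M : ℝ} (hM : 0 < M) {f : ℝ → ℝ} (h : ∀ t, f t ≠ 0 → |t| < M) :
    ∫ t, f t = ∫ t in (-M)..M, f t := by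
  rw [intervalIntegral.integral_of_le (by linarith), setIntegral_eq_integral_of_forall_compl_eq_zero]
  intro t ht
  by_contra h0
  have := abs_lt.1 (h t h0)
  exact ht ⟨this.1, this.2.le⟩

lemma integrable_of_supp {n : ℕ} {M : ℝ} {F : (Fin n → ℝ) → ℝ} (hF : Continuous F)
    (h : ∀ x, F x ≠ 0 → ∀ i, |x i| < M) : Integrable F := by
  refine hF.integrable_of_hasCompactSupport ?_
  refine HasCompactSupport.intro (isCompact_Q n M) fun x hx => ?_
  by_contra h0
  exact hx fun i => (h x h0 i).le


lemma strictMono_prim {g : ℝ → ℝ} (hg : Continuous g) (hpos : ∀ t, 0 < g t) (a : ℝ) :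
    StrictMono (fun s => ∫ t in a..s, g t) := by
  intro s s' hs
  have h1 : 0 < ∫ t in s..s', g t :=
    intervalIntegral.intervalIntegral_pos_of_pos (hg.intervalIntegrable _ _) hpos hs
  have h2 := intervalIntegral.integral_add_adjacent_intervals (hg.intervalIntegrable (μ := volume) a s)
    (hg.intervalIntegrable (μ := volume) s s')
  simp only; linarith

lemma oneD_exists {M R : ℝ} (hM : 0 < M) (hR : 0 < R) {f g : ℝ → ℝ} (hf : Continuous f)
    (hf0 : ∀ t, 0 ≤ f t) (hsupp : ∀ t, f t ≠ 0 → |t| < M) (hg : Continuous g) (hpos : ∀ t, 0 < g t)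
    (t : ℝ) : ∃ s, ((∫ t in (-M)..M, f t) = 0 → s = 0) ∧ |s| ≤ R ∧
      (∫ t in (-M)..M, f t) * (∫ r in (-R)..s, g r) =
        (∫ r in (-R)..R, g r) * (∫ r in (-M)..t, f r) := by
  have hzero : ∀ r, M ≤ |r| → f r = 0 := fun r hr => by
    by_contra h; exact absurd (hsupp r h) (not_lt.2 hr)
  have hlow : 0 ≤ ∫ r in (-M)..t, f r := by
    rcases le_total (-M) t with h | h
    · exact intervalIntegral.integral_nonneg h fun r _ => hf0 r
    · rw [intervalIntegral.integral_congr (g := fun _ => 0)]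
      · simp
      · intro r hr
        rw [Set.uIcc_of_ge h] at hr
        apply hzero
        rw [abs_of_nonpos (by linarith [hr.2])]; linarith [hr.2]
  have hup : ∫ r in (-M)..t, f r ≤ ∫ r in (-M)..M, f r := by
    have h2 := intervalIntegral.integral_add_adjacent_intervals
      (hf.intervalIntegrable (μ := volume) (-M) t) (hf.intervalIntegrable (μ := volume) t M)
    have h3 : 0 ≤ ∫ r in t..M, f r := by
      rcases le_total t M with h | h
      · exact intervalIntegral.integral_nonneg h fun r _ => hf0 r
      · rw [intervalIntegral.integral_congr (g := fun _ => 0)]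
        · simp
        · intro r hr
          rw [Set.uIcc_of_ge h] at hr
          apply hzero
          rw [abs_of_nonneg (by linarith [hr.1])]; linarith [hr.1]
    linarith
  by_cases h0 : (∫ t in (-M)..M, f t) = 0
  · refine ⟨0, fun _ => rfl, by simpa using hR.le, ?_⟩
    have : (∫ r in (-M)..t, f r) = 0 := by linarith
    rw [h0, this]; ring
  · have hF : 0 < ∫ t in (-M)..M, f t := lt_of_le_of_ne (hlow.trans hup) (Ne.symm h0)
    have hG : 0 < ∫ r in (-R)..R, g r :=
      intervalIntegral.intervalIntegral_pos_of_pos (hg.intervalIntegrable _ _) hpos (by linarith)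
    have hc : ContinuousOn (fun s => ∫ r in (-R)..s, g r) (Set.Icc (-R) R) :=
      (intervalIntegral.continuous_primitive (fun a b => hg.intervalIntegrable a b) _).continuousOn
    have hiv := intermediate_value_Icc (by linarith : -R ≤ R) hc
    obtain ⟨s, hs, hs'⟩ : (∫ r in (-R)..R, g r) * (∫ r in (-M)..t, f r) / (∫ t in (-M)..M, f t) ∈
      (fun s => ∫ r in (-R)..s, g r) '' Set.Icc (-R) R := by
      apply hiv
      constructor
      · simp only [intervalIntegral.integral_same]; positivity
      · rw [div_le_iff₀ hF]; gcongr
    refine ⟨s, fun h => absurd h h0, abs_le.2 hs, ?_⟩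
    simp only at hs'
    rw [hs']; field_simp

lemma oneD {M R : ℝ} (hM : 0 < M) (hR : 0 < R) {f g τ : ℝ → ℝ} (hf : Continuous f)
    (hsupp : ∀ t, f t ≠ 0 → |t| < M) (hg : Continuous g) (hpos : ∀ t, 0 < g t)
    (hF : 0 < ∫ t in (-M)..M, f t) (hτR : ∀ t, |τ t| ≤ R)
    (hτ : ∀ t, (∫ t in (-M)..M, f t) * (∫ r in (-R)..(τ t), g r) =
        (∫ r in (-R)..R, g r) * (∫ r in (-M)..t, f r)) :
    (∀ t, HasDerivAt τ ((∫ r in (-R)..R, g r) * f t / ((∫ t in (-M)..M, f t) * g (τ t))) t) ∧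
    ∀ h : ℝ → ℝ, Continuous h → ∫ t, h (τ t) * f t =
      (∫ t in (-M)..M, f t) * ((∫ r in (-R)..R, h r * g r) / (∫ r in (-R)..R, g r)) := by
  set A := ∫ t in (-M)..M, f t with hA
  set B := ∫ r in (-R)..R, g r with hB
  have hBpos : 0 < B :=
    intervalIntegral.intervalIntegral_pos_of_pos (hg.intervalIntegrable _ _) hpos (by linarith)
  have hmono := strictMono_prim hg hpos (-R)
  obtain ⟨s₀, hs₀, hmin⟩ := (isCompact_Icc (a := -R) (b := R)).exists_isMinOn
    ⟨0, by constructor <;> linarith⟩ hg.continuousOn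
  have hm : 0 < g s₀ := hpos s₀
  have hΦ : ∀ t, HasDerivAt (fun t => B * (∫ r in (-M)..t, f r) / A) (B * f t / A) t := fun t =>
    ((intervalIntegral.integral_hasDerivAt_right (hf.intervalIntegrable _ _)
      (hf.stronglyMeasurableAtFilter _ _) hf.continuousAt).const_mul B).div_const A
  have hHτ : ∀ t, (∫ r in (-R)..(τ t), g r) = B * (∫ r in (-M)..t, f r) / A := fun t => by
    rw [eq_div_iff hF.ne', mul_comm]; exact hτ t
  have key : ∀ s s', |s| ≤ R → |s'| ≤ R → s ≤ s' →
      g s₀ * (s' - s) ≤ (∫ r in (-R)..s', g r) - ∫ r in (-R)..s, g r := by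
    intro s s' h1 h2 h3
    rw [intervalIntegral.integral_interval_sub_left (hg.intervalIntegrable _ _)
      (hg.intervalIntegrable _ _)]
    have : ∫ r in s..s', g s₀ ≤ ∫ r in s..s', g r := by
      apply intervalIntegral.integral_mono_on h3 (by simp) (hg.intervalIntegrable _ _)
      intro r hr
      exact hmin ⟨(abs_le.1 h1).1.trans hr.1, hr.2.trans (abs_le.1 h2).2⟩
    simpa [mul_comm] using this
  have key2 : ∀ t t', g s₀ * |τ t - τ t'| ≤
      |B * (∫ r in (-M)..t, f r) / A - B * (∫ r in (-M)..t', f r) / A| := by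
    intro t t'
    rw [← hHτ, ← hHτ]
    rcases le_total (τ t) (τ t') with h | h
    · rw [abs_sub_comm, abs_of_nonneg (by linarith), abs_sub_comm]
      exact (key _ _ (hτR t) (hτR t') h).trans (le_abs_self _)
    · rw [abs_of_nonneg (by linarith)]
      exact (key _ _ (hτR t') (hτR t) h).trans (le_abs_self _)
  have hτc : ∀ t, ContinuousAt τ t := by
    intro t
    have h1 := (hΦ t).continuousAt
    rw [ContinuousAt, tendsto_iff_dist_tendsto_zero] at h1 ⊢
    have h2 := h1.const_mul (1 / g s₀)
    rw [mul_zero] at h2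
    refine squeeze_zero (fun _ => dist_nonneg) (fun r => ?_) h2
    rw [Real.dist_eq, Real.dist_eq, one_div, ← div_eq_inv_mul, le_div_iff₀ hm, mul_comm]
    exact key2 r t
  have hder : ∀ t, HasDerivAt τ (B * f t / (A * g (τ t))) t := by
    intro t
    have := hasDerivAt_of_comp_eq (H := fun s => ∫ r in (-R)..s, g r)
      (intervalIntegral.integral_hasStrictDerivAt_right (hg.intervalIntegrable (-R) (τ t))
      (hg.stronglyMeasurableAtFilter _ _) hg.continuousAt) (hpos (τ t)).ne' (hτc t) hHτ (hΦ t)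
    rwa [div_div] at this
  refine ⟨hder, fun h hh => ?_⟩
  have hτcont : Continuous τ := continuous_iff_continuousAt.2 hτc
  have e1 : τ (-M) = -R := by
    apply hmono.injective
    simp only [hHτ]; simp
  have e2 : τ M = R := by
    apply hmono.injective
    simp only [hHτ]; rw [← hA, ← hB]; field_simp
  have hsub := intervalIntegral.integral_comp_mul_deriv (a := -M) (b := M)
    (fun t _ => hder t) (g := fun s => h s * g s)
    (by
      apply Continuous.continuousOn
      refine (continuous_const.mul hf).div (continuous_const.mul (hg.comp hτcont)) fun t => ?_
      exact (mul_pos hF (hpos _)).ne') (hh.mul hg)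
  rw [e1, e2] at hsub
  rw [integral_supp hM (f := fun t => h (τ t) * f t)
    (fun t ht => hsupp t (right_ne_zero_of_mul ht)), ← hsub, ← intervalIntegral.integral_div,
    ← intervalIntegral.integral_const_mul]
  apply intervalIntegral.integral_congr
  intro t _
  have := (hpos (τ t)).ne'
  simp only [Function.comp]
  field_simp


lemma continuous_slice_integral {n : ℕ} {k : (Fin (n + 1) → ℝ) → ℝ} (hk : Continuous k) (a : ℝ) :
    Continuous (fun p : ℝ × (Fin n → ℝ) => ∫ t in a..p.1, k (cns t p.2)) := by
  have : Continuous (Function.uncurry fun (p : ℝ × (Fin n → ℝ)) (t : ℝ) => k (cns t p.2)) :=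
    hk.comp (Continuous.cns' continuous_snd (continuous_snd.comp continuous_fst))
  exact intervalIntegral.continuous_parametric_intervalIntegral_of_continuous this continuous_fst

lemma continuous_slice_integral' {n : ℕ} {k : (Fin (n + 1) → ℝ) → ℝ} (hk : Continuous k)
    (a b : ℝ) : Continuous (fun y : Fin n → ℝ => ∫ t in a..b, k (cns t y)) :=
  (continuous_slice_integral hk a).comp (continuous_const.prodMk continuous_id)

/-- Existence of the Knothe map. -/
theorem knothe (n : ℕ) : ∀ (F G : (Fin n → ℝ) → ℝ) (M R : ℝ), 0 < M → 0 < R →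
    Continuous F → (∀ x, 0 ≤ F x) → (∀ x, F x ≠ 0 → ∀ i, |x i| < M) →
    Continuous G → (∀ x, 0 < G x) → (∫ x, F x = ∫ x in Q n R, G x) →
    ∃ T D : (Fin n → ℝ) → (Fin n → ℝ), Measurable T ∧ Measurable D ∧ (∀ x, T x ∈ Q n R) ∧
      (∀ x i, 0 ≤ D x i) ∧ (∀ x, F x = G (T x) * ∏ i, D x i) ∧
      (∀ x i, (∃ t, F (Function.update x i t) ≠ 0) → ∀ s,
        HasDerivAt (fun t => T (Function.update x i t) i) (D (Function.update x i s) i) s) ∧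
      ∀ h : (Fin n → ℝ) → ℝ, Continuous h → ∫ x, h (T x) * F x = ∫ x in Q n R, h x * G x := by
  induction n with
  | zero =>
    intro F G M R hM hR hF hF0 hFs hG hG0 heq
    have hQ : Q 0 R = Set.univ := by ext x; simp [Q]
    have hv : (volume : Measure (Fin 0 → ℝ)) = Measure.dirac default := by
      rw [volume_pi, Measure.pi_of_empty _ default]
    have hFG : ∀ x, F x = G x := by
      intro x
      rw [hQ, hv] at heq
      simp only [Measure.restrict_univ, integral_dirac] at heq
      rw [Subsingleton.elim x default]; exact heq
    refine ⟨id, fun x => x, measurable_id, measurable_id, fun x i => i.elim0, fun x i => i.elim0,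
      fun x => by simp [hFG], fun x i => i.elim0, fun h hh => ?_⟩
    rw [hQ]; simp [hFG]
  | succ n ih =>
    intro F G M R hM hR hF hF0 hFs hG hG0 heq
    set F' : (Fin n → ℝ) → ℝ := fun y => ∫ t in (-M)..M, F (cns t y) with hF'
    set G' : (Fin n → ℝ) → ℝ := fun y => ∫ t in (-R)..R, G (cns t y) with hG'
    have cF : ∀ y, Continuous (fun t => F (cns t y)) := fun y =>
      hF.comp (Continuous.cns' continuous_id continuous_const)
    have cG : ∀ y, Continuous (fun t => G (cns t y)) := fun y =>
      hG.comp (Continuous.cns' continuous_id continuous_const)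
    have sF : ∀ y t, F (cns t y) ≠ 0 → |t| < M := fun y t h => by simpa using hFs _ h 0
    have hF'c : Continuous F' := continuous_slice_integral' hF _ _
    have hG'c : Continuous G' := continuous_slice_integral' hG _ _
    have hF'0 : ∀ y, 0 ≤ F' y := fun y =>
      intervalIntegral.integral_nonneg (by linarith) fun t _ => hF0 _
    have hG'0 : ∀ y, 0 < G' y := fun y =>
      intervalIntegral.intervalIntegral_pos_of_pos ((cG y).intervalIntegrable _ _)
        (fun t => hG0 _) (by linarith)
    have hF's : ∀ y, F' y ≠ 0 → ∀ i, |y i| < M := by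
      intro y hy i
      by_contra hcon
      apply hy
      have : ∀ t, F (cns t y) = 0 := fun t => by
        by_contra h0
        exact hcon (by simpa using hFs _ h0 i.succ)
      simp [hF', this]
    have hF'pos : ∀ y t, F (cns t y) ≠ 0 → 0 < F' y := by
      intro y t ht
      have h1 := abs_lt.1 (sF y t ht)
      refine intervalIntegral.integral_pos (by linarith) (cF y).continuousOn
        (fun _ _ => hF0 _) ⟨t, ⟨h1.1.le, h1.2.le⟩, lt_of_le_of_ne (hF0 _) ht.symm⟩
    have hFint : Integrable F := integrable_of_supp hF hFs
    have heq' : ∫ y, F' y = ∫ y in Q n R, G' y := by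
      rw [← integral_Q hR hG, ← heq, integral_cns hFint]
      congr 1; funext y
      exact (integral_supp hM (sF y)).symm
    obtain ⟨T', D', mT', mD', hT'Q, hD'0, hprod', hder', htr'⟩ :=
      ih F' G' M R hM hR hF'c hF'0 hF's hG'c hG'0 heq'
    have hex : ∀ (y : Fin n → ℝ) (t : ℝ), ∃ s, (F' y = 0 → s = 0) ∧ |s| ≤ R ∧
        F' y * (∫ r in (-R)..s, G (cns r (T' y))) = G' (T' y) * ∫ r in (-M)..t, F (cns r y) :=
      fun y t => oneD_exists hM hR (cF y) (fun _ => hF0 _) (sF y) (cG (T' y)) (fun _ => hG0 _) t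
    choose τ hτ0 hτR hτeq using hex
    have hone : ∀ y, 0 < F' y → _ := fun y hy =>
      oneD hM hR (cF y) (sF y) (cG (T' y)) (fun _ => hG0 _) hy (hτR y) (hτeq y)
    have mτ : Measurable (fun x : Fin (n + 1) → ℝ => τ (tl x) (x 0)) := by
      refine measurable_of_Iic fun s => ?_
      have hset : (fun x : Fin (n + 1) → ℝ => τ (tl x) (x 0)) ⁻¹' Set.Iic s =
          ({x | F' (tl x) = 0} ∩ {_x | 0 ≤ s}) ∪ ({x | F' (tl x) ≠ 0} ∩
            {x | G' (T' (tl x)) * (∫ r in (-M)..(x 0), F (cns r (tl x))) ≤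
              F' (tl x) * (∫ r in (-R)..s, G (cns r (T' (tl x))))}) := by
        ext x
        by_cases h : F' (tl x) = 0
        · simp [h, hτ0 _ _ h]
        · have hp : 0 < F' (tl x) := lt_of_le_of_ne (hF'0 _) (Ne.symm h)
          simp only [Set.mem_preimage, Set.mem_Iic, Set.mem_union, Set.mem_inter_iff,
            Set.mem_ofPred_eq, h, false_and, false_or, ne_eq, not_false_eq_true, true_and]
          rw [← hτeq, mul_le_mul_iff_right₀ hp]
          exact ((strictMono_prim (cG (T' (tl x))) (fun _ => hG0 _) (-R)).le_iff_le).symm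
      rw [hset]
      have m1 : Measurable (fun x : Fin (n + 1) → ℝ => F' (tl x)) :=
        (hF'c.comp continuous_tl).measurable
      have m2 : Measurable (fun x : Fin (n + 1) → ℝ => T' (tl x)) :=
        mT'.comp continuous_tl.measurable
      refine MeasurableSet.union (MeasurableSet.inter (m1 (measurableSet_singleton 0))
        (MeasurableSet.const _)) (MeasurableSet.inter (m1 (measurableSet_singleton 0).compl)
        (measurableSet_le ((hG'c.measurable.comp m2).mul ?_) (m1.mul ?_)))
      · exact ((continuous_slice_integral hF (-M)).comp
          ((continuous_apply 0).prodMk continuous_tl)).measurable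
      · exact (continuous_slice_integral' hG (-R) s).measurable.comp m2
    set T : (Fin (n+1) → ℝ) → (Fin (n+1) → ℝ) := fun x => cns (τ (tl x) (x 0)) (T' (tl x)) with hT
    set d : (Fin (n+1) → ℝ) → ℝ := fun x => G' (T' (tl x)) * F x / (F' (tl x) * G (T x)) with hd
    set D : (Fin (n+1) → ℝ) → (Fin (n+1) → ℝ) := fun x => cns (d x) (D' (tl x)) with hD
    have mT : Measurable T := continuous_cns.measurable.comp
      (mτ.prodMk (mT'.comp continuous_tl.measurable))
    have md : Measurable d :=
      ((hG'c.measurable.comp (mT'.comp continuous_tl.measurable)).mul hF.measurable).div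
        ((hF'c.comp continuous_tl).measurable.mul (hG.measurable.comp mT))
    have hTQ : ∀ x, T x ∈ Q (n+1) R := fun x => cns_mem_Q.2 ⟨hτR _ _, hT'Q _⟩
    refine ⟨T, D, mT, continuous_cns.measurable.comp
      (md.prodMk (mD'.comp continuous_tl.measurable)), hTQ, ?_, ?_, ?_, ?_⟩
    · intro x i
      refine Fin.cases ?_ (fun j => ?_) i
      · simp only [hD, cns_zero, hd]
        exact div_nonneg (mul_nonneg (hG'0 _).le (hF0 _)) (mul_nonneg (hF'0 _) (hG0 _).le)
      · simpa [hD] using hD'0 _ j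
    · intro x
      simp only [hD, Fin.prod_univ_succ, cns_zero, cns_succ]
      by_cases h : F x = 0
      · simp [hd, h]
      · have hp : 0 < F' (tl x) := hF'pos (tl x) (x 0) (by simpa using h)
        have h1 := hprod' (tl x)
        have h2 := (hG'0 (T' (tl x))).ne'
        have h3 := (hG0 (T x)).ne'
        have h4 : ∏ i, D' (tl x) i = F' (tl x) / G' (T' (tl x)) := by
          rw [eq_div_iff h2, mul_comm]; exact h1.symm
        rw [h4]; simp only [hd]; field_simp
    · intro x i
      refine Fin.cases ?_ (fun j => ?_) i
      · rintro ⟨t, ht⟩ s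
        have hu : ∀ t, Function.update x 0 t = cns t (tl x) := by
          intro t; funext k
          refine Fin.cases ?_ (fun j => ?_) k
          · simp
          · simp [tl]
        simp only [hu] at ht ⊢
        simpa [hT, hD, hd] using (hone (tl x) (hF'pos _ _ ht)).1 s
      · rintro ⟨t, ht⟩ s
        have hu : ∀ t, Function.update x j.succ t = cns (x 0) (Function.update (tl x) j t) := by
          intro t; funext k
          refine Fin.cases ?_ (fun l => ?_) k
          · simp [Function.update_of_ne (Fin.succ_ne_zero j).symm]
          · by_cases hl : l = j
            · subst hl; simp
            · simp [Function.update_of_ne hl, Function.update_of_ne (fun h => hl (Fin.succ_inj.1 h)), tl]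
        simp only [hu] at ht ⊢
        simpa [hT, hD] using hder' (tl x) j ⟨t, (hF'pos _ _ ht).ne'⟩ s
    · intro h hh
      obtain ⟨C, hC⟩ := (isCompact_Q (n+1) R).exists_bound_of_continuousOn hh.continuousOn
      have hInteg : Integrable (fun x => h (T x) * F x) :=
        hFint.bdd_mul (hh.measurable.comp mT).aestronglyMeasurable
          (Filter.Eventually.of_forall fun x => hC _ (hTQ x))
      have hhG : Continuous (fun x => h x * G x) := hh.mul hG
      rw [integral_cns hInteg, integral_Q hR hhG]
      have hk : Continuous (fun y => (∫ t in (-R)..R, h (cns t y) * G (cns t y)) / G' y) :=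
        (continuous_slice_integral' hhG _ _).div hG'c fun y => (hG'0 y).ne'
      have := htr' _ hk
      rw [show (fun x => (∫ t in (-R)..R, h (cns t x) * G (cns t x)) / G' x * G' x) =
        fun x => (∫ t in (-R)..R, h (cns t x) * G (cns t x)) from funext fun y =>
          div_mul_cancel₀ _ (hG'0 y).ne'] at this
      rw [← this]
      congr 1; funext y
      by_cases hy : F' y = 0
      · rw [hy, mul_zero]
        have : ∀ t, F (cns t y) = 0 := fun t => by
          by_contra h0
          exact (hF'pos y t h0).ne' hy
        simp [this]
      · have hp : 0 < F' y := lt_of_le_of_ne (hF'0 _) (Ne.symm hy)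
        have h2 := (hone y hp).2 (fun s => h (cns s (T' y)))
          (hh.comp (Continuous.cns' continuous_id continuous_const))
        simp only [hT, tl_cns, cns_zero]
        rw [h2, mul_comm]


lemma hasDerivAt_abs_cube (s : ℝ) : HasDerivAt (fun s : ℝ => |s| ^ 3) (3 * s * |s|) s := by
  have h := hasDerivAt_abs_rpow s (p := 3) (by norm_num)
  have e1 : (fun x : ℝ => |x| ^ (3 : ℝ)) = fun s : ℝ => |s| ^ 3 := by
    funext x; norm_cast
  rw [e1] at h
  convert h using 1
  have : (3 : ℝ) - 2 = 1 := by norm_num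
  rw [this, Real.rpow_one]; ring

lemma ibp {m : ℕ} {u : (Fin (m + 1) → ℝ) → ℝ} (hu : Differentiable ℝ u) {M R : ℝ}
    (hsupp : ∀ x, u x ≠ 0 → ∀ i, |x i| < M) (i : Fin (m + 1)) {T D : (Fin (m + 1) → ℝ) → ℝ}
    (mT : Measurable T) (mD : Measurable D) (hT : ∀ x, |T x| ≤ R) (hD : ∀ x, 0 ≤ D x)
    (hder : ∀ x, (∃ t, u (Function.update x i t) ≠ 0) → ∀ s,
      HasDerivAt (fun t => T (Function.update x i t)) (D (Function.update x i s)) s)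
    (hp : Integrable (fun x => (fderiv ℝ u x (Pi.single i 1)) ^ 2)) :
    Integrable (fun x => 3 * u x * |u x| * fderiv ℝ u x (Pi.single i 1) * T x) ∧
    Integrable (fun x => |u x| ^ 3 * D x) ∧
    ∫ x, |u x| ^ 3 * D x = - ∫ x, 3 * u x * |u x| * fderiv ℝ u x (Pi.single i 1) * T x := by
  have huc : Continuous u := hu.continuous
  have mp : Measurable (fun x => fderiv ℝ u x (Pi.single i 1)) := measurable_fderiv_apply_const ℝ u _
  have hu4 : Integrable (fun x => u x ^ 4) :=
    integrable_of_supp (huc.pow 4) fun x hx => hsupp x (fun h => hx (by simp [h]))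
  have hw : Integrable (fun x => 3 * u x * |u x| * fderiv ℝ u x (Pi.single i 1) * T x) := by
    refine Integrable.mono' (g := fun x => (3/2) * ((fderiv ℝ u x (Pi.single i 1)) ^ 2
      + R ^ 2 * u x ^ 4)) ((hp.add (hu4.const_mul _)).const_mul _) ?_ ?_
    · have := huc.measurable
      exact (by fun_prop : Measurable (fun x => 3 * u x * |u x| * fderiv ℝ u x (Pi.single i 1)
        * T x)).aestronglyMeasurable
    · refine Filter.Eventually.of_forall fun x => ?_
      rw [Real.norm_eq_abs, abs_mul, abs_mul, abs_mul, abs_mul, abs_abs]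
      set p := |fderiv ℝ u x (Pi.single i 1)| with hp'
      have e : (fderiv ℝ u x (Pi.single i 1)) ^ 2 = p ^ 2 := (sq_abs _).symm
      have e4 : u x ^ 4 = |u x| ^ 4 := by
        rw [show u x ^ 4 = (u x ^ 2) ^ 2 by ring, ← sq_abs (u x)]; ring
      rw [e, e4]
      have h1 := hT x
      have h0 := abs_nonneg (T x)
      have h2 : |T x| ^ 2 ≤ R ^ 2 := pow_le_pow_left₀ h0 h1 2
      have h3 := sq_nonneg (p - |u x| ^ 2 * |T x|)
      have h4 := mul_le_mul_of_nonneg_left h2 (by positivity : 0 ≤ |u x| ^ 4)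
      rw [abs_of_pos (by norm_num : (0:ℝ) < 3)]
      nlinarith
  -- the statement on lines
  have hline : ∀ y : Fin m → ℝ,
      Integrable (fun t => 3 * u (i.insertNth t y) * |u (i.insertNth t y)| *
        fderiv ℝ u (i.insertNth t y) (Pi.single i 1) * T (i.insertNth t y)) →
      Integrable (fun t => |u (i.insertNth t y)| ^ 3 * D (i.insertNth t y)) ∧
      ∫ t, |u (i.insertNth t y)| ^ 3 * D (i.insertNth t y) =
        - ∫ t, 3 * u (i.insertNth t y) * |u (i.insertNth t y)| *
        fderiv ℝ u (i.insertNth t y) (Pi.single i 1) * T (i.insertNth t y) := by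
    intro y
    obtain ⟨x, hins⟩ : ∃ x : Fin (m + 1) → ℝ, ∀ t : ℝ, (i.insertNth t y : Fin (m + 1) → ℝ) =
        Function.update x i t := ⟨i.insertNth (0:ℝ) y, fun t => by simp⟩
    simp only [hins]
    intro hwy
    by_cases hex : ∃ t, u (Function.update x i t) ≠ 0
    · have hd := hder x hex
      have hul : ∀ s, HasDerivAt (fun t => u (Function.update x i t))
          (fderiv ℝ u (Function.update x i s) (Pi.single i 1)) s := fun s =>
        (hu _).hasFDerivAt.comp_hasDerivAt s (hasDerivAt_update x i s)
      have hcu : Continuous (fun t => u (Function.update x i t)) :=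
        continuous_iff_continuousAt.2 fun s => (hul s).continuousAt
      have hcT : Continuous (fun t => T (Function.update x i t)) :=
        continuous_iff_continuousAt.2 fun s => (hd s).continuousAt
      have hsl : ∀ t, u (Function.update x i t) ≠ 0 → |t| < M := fun t ht => by
        simpa using hsupp _ ht i
      have hDi : IntegrableOn (fun t => D (Function.update x i t)) (Set.Ioc (-M) M) :=
        intervalIntegral.integrableOn_deriv_of_nonneg hcT.continuousOn (fun t _ => hd t)
          (fun t _ => hD _)
      have hcs : HasCompactSupport (fun t => |u (Function.update x i t)| ^ 3) := by
        refine HasCompactSupport.intro (isCompact_Icc (a := -M) (b := M)) fun t ht => ?_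
        by_contra h0
        have h1 : u (Function.update x i t) ≠ 0 := fun h => h0 (by simp [h])
        have := abs_lt.1 (hsl t h1)
        exact ht ⟨this.1.le, this.2.le⟩
      have hc3 : Continuous (fun t => |u (Function.update x i t)| ^ 3) := hcu.abs.pow 3
      have hI1 : Integrable (fun t => |u (Function.update x i t)| ^ 3 * D (Function.update x i t)) := by
        obtain ⟨C, hC⟩ := hc3.bounded_above_of_compact_support hcs
        have h1 : IntegrableOn (fun t => |u (Function.update x i t)| ^ 3 *
            D (Function.update x i t)) (Set.Ioc (-M) M) :=
          Integrable.bdd_mul (c := C) hDi hc3.aestronglyMeasurable (Filter.Eventually.of_forall hC)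
        rw [← integrable_indicator_iff measurableSet_Ioc] at h1
        have hsub : Function.support (fun t => |u (Function.update x i t)| ^ 3 *
            D (Function.update x i t)) ⊆ Set.Ioc (-M) M := by
          intro t ht
          have h2 : u (Function.update x i t) ≠ 0 := fun h => by simp [h] at ht
          have := abs_lt.1 (hsl t h2)
          exact ⟨this.1, this.2.le⟩
        rwa [Set.indicator_eq_self.2 hsub] at h1
      refine ⟨hI1, ?_⟩
      have hv : ∀ s, HasDerivAt (fun t => |u (Function.update x i t)| ^ 3)
          (3 * u (Function.update x i s) * |u (Function.update x i s)| *
            fderiv ℝ u (Function.update x i s) (Pi.single i 1)) s := fun s =>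
        (hasDerivAt_abs_cube _).comp s (hul s)
      exact integral_mul_deriv_eq_deriv_mul_of_integrable (fun s _ => hv s) (fun s _ => hd s) hI1 hwy
        ((hc3.mul hcT).integrable_of_hasCompactSupport hcs.mul_right)
    · push Not at hex
      simp [hex]
  have hwp := (integrable_insertNth i _).2 hw
  have hae : ∀ᵐ y : Fin m → ℝ, Integrable (fun t => 3 * u (i.insertNth t y) *
      |u (i.insertNth t y)| * fderiv ℝ u (i.insertNth t y) (Pi.single i 1) *
      T (i.insertNth t y)) := hwp.prod_left_ae
  have hI : Integrable (fun x => |u x| ^ 3 * D x) := by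
    rw [← integrable_insertNth i, integrable_prod_iff']
    · constructor
      · filter_upwards [hae] with y hy using (hline y hy).1
      · refine hwp.integral_prod_right.neg.congr ?_
        filter_upwards [hae] with y hy
        rw [Pi.neg_apply, ← (hline y hy).2]
        congr 1; funext t
        exact (Real.norm_of_nonneg (mul_nonneg (by positivity) (hD _))).symm
    · have m1 := huc.measurable
      exact ((by fun_prop : Measurable (fun x => |u x| ^ 3 * D x)).comp
        (me_insertNth i).measurable).aestronglyMeasurable
  refine ⟨hw, hI, ?_⟩
  rw [integral_insertNth i hI, integral_insertNth i hw, ← integral_neg]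
  refine integral_congr_ae ?_
  filter_upwards [hae] with y hy using (hline y hy).2


/-- The ground state in coordinates. -/
noncomputable def w (x : Fin 4 → ℝ) : ℝ := (1 + (∑ i, x i ^ 2) / 8)⁻¹

lemma w_den_pos (x : Fin 4 → ℝ) : 0 < 1 + (∑ i, x i ^ 2) / 8 := by positivity
lemma w_pos (x : Fin 4 → ℝ) : 0 < w x := inv_pos.2 (w_den_pos x)
lemma w_cont : Continuous w := by
  unfold w
  exact Continuous.inv₀ (by fun_prop) fun x => (w_den_pos x).ne'

lemma amgm (a g d0 d1 d2 d3 : ℝ) (ha : 0 ≤ a) (hg : 0 < g) (h0 : 0 ≤ d0) (h1 : 0 ≤ d1)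
    (h2 : 0 ≤ d2) (h3 : 0 ≤ d3) (h : a ^ 4 = g ^ 4 * (d0 * d1 * d2 * d3)) :
    g⁻¹ * a ^ 4 ≤ a ^ 3 * ((d0 + d1 + d2 + d3) / 4) := by
  have e : d0 * d1 * d2 * d3 ≤ ((d0 + d1 + d2 + d3) / 4) ^ 4 := by
    have e1 : d0 * d1 ≤ ((d0 + d1) / 2) ^ 2 := by nlinarith [sq_nonneg (d0 - d1)]
    have e2 : d2 * d3 ≤ ((d2 + d3) / 2) ^ 2 := by nlinarith [sq_nonneg (d2 - d3)]
    have e3 : ((d0 + d1) / 2) * ((d2 + d3) / 2) ≤ ((d0 + d1 + d2 + d3) / 4) ^ 2 := by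
      nlinarith [sq_nonneg (d0 + d1 - d2 - d3)]
    calc d0 * d1 * d2 * d3 = (d0 * d1) * (d2 * d3) := by ring
      _ ≤ ((d0 + d1) / 2) ^ 2 * ((d2 + d3) / 2) ^ 2 := by gcongr
      _ = (((d0 + d1) / 2) * ((d2 + d3) / 2)) ^ 2 := by ring
      _ ≤ (((d0 + d1 + d2 + d3) / 4) ^ 2) ^ 2 := by gcongr
      _ = _ := by ring
  have h4 : (a / g) ^ 4 ≤ ((d0 + d1 + d2 + d3) / 4) ^ 4 := by
    rw [div_pow, h, mul_div_cancel_left₀ _ (by positivity)]; exact e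
  have h5 : a / g ≤ (d0 + d1 + d2 + d3) / 4 := le_of_pow_le_pow_left₀ (by norm_num) (by positivity) h4
  calc g⁻¹ * a ^ 4 = a ^ 3 * (a / g) := by ring
    _ ≤ _ := by gcongr

lemma key {u : (Fin 4 → ℝ) → ℝ} (hu : Differentiable ℝ u) {M R : ℝ} (hM : 0 < M) (hR : 0 < R)
    (hsupp : ∀ x, u x ≠ 0 → ∀ i, |x i| < M)
    (hp : ∀ i, Integrable (fun x => (fderiv ℝ u x (Pi.single i 1)) ^ 2))
    (heq : ∫ x, u x ^ 4 = ∫ x in Q 4 R, w x ^ 4) :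
    ∫ x in Q 4 R, w x ^ 3 ≤ (3 / 2) * (∫ x, ∑ i, (fderiv ℝ u x (Pi.single i 1)) ^ 2)
      + (3 / 32) * ∫ x in Q 4 R, (∑ i, x i ^ 2) * w x ^ 4 := by
  have huc := hu.continuous
  have hs4 : ∀ x, u x ^ 4 ≠ 0 → ∀ i, |x i| < M := fun x hx => hsupp x (fun h => hx (by simp [h]))
  have hu4 : Integrable (fun x => u x ^ 4) := integrable_of_supp (huc.pow 4) hs4
  obtain ⟨T, D, mT, mD, hTQ, hD0, hprod, hder, htr⟩ := knothe 4 (fun x => u x ^ 4)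
    (fun x => w x ^ 4) M R hM hR (huc.pow 4) (fun x => by positivity) hs4 (w_cont.pow 4)
    (fun x => pow_pos (w_pos x) 4) heq
  have hib := fun i => ibp hu hsupp i (measurable_pi_iff.1 mT i) (measurable_pi_iff.1 mD i)
    (fun x => hTQ x i) (fun x => hD0 x i)
    (fun x ⟨t, ht⟩ => hder x i ⟨t, pow_ne_zero 4 ht⟩) (hp i)
  have hwi : Continuous (fun x => (w x)⁻¹) := w_cont.inv₀ fun x => (w_pos x).ne'
  have hInteg : ∀ h : (Fin 4 → ℝ) → ℝ, Continuous h → Integrable (fun x => h (T x) * u x ^ 4) := by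
    intro h hh
    obtain ⟨C, hC⟩ := (isCompact_Q 4 R).exists_bound_of_continuousOn hh.continuousOn
    exact hu4.bdd_mul (hh.measurable.comp mT).aestronglyMeasurable
      (Filter.Eventually.of_forall fun x => hC _ (hTQ x))
  have hsq : Continuous (fun x : Fin 4 → ℝ => ∑ i, x i ^ 2) := by fun_prop
  have t1 := htr _ hwi
  have t2 := htr _ hsq
  have e1 : ∫ x in Q 4 R, w x ^ 3 = ∫ x, (w (T x))⁻¹ * u x ^ 4 := by
    rw [t1]; congr 1; funext x
    have := (w_pos x).ne'
    field_simp
  rw [e1, ← t2]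
  have s1 : ∫ x, (w (T x))⁻¹ * u x ^ 4 ≤ ∫ x, (1 / 4) * ∑ i, |u x| ^ 3 * D x i := by
    refine integral_mono (hInteg _ hwi) ((integrable_finsetSum _ fun i _ => (hib i).2.1).const_mul _)
      fun x => ?_
    have e4 : u x ^ 4 = |u x| ^ 4 := by
      rw [show u x ^ 4 = (u x ^ 2) ^ 2 by ring, ← sq_abs (u x)]; ring
    have hpx := hprod x
    simp only [Fin.prod_univ_four] at hpx
    rw [e4] at hpx
    have := amgm _ _ _ _ _ _ (abs_nonneg (u x)) (w_pos (T x)) (hD0 x 0) (hD0 x 1) (hD0 x 2)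
      (hD0 x 3) hpx
    simp only [Fin.sum_univ_four]
    rw [e4]; linarith
  have hneg : ∀ i, Integrable
      (fun x => -(3 * u x * |u x| * fderiv ℝ u x (Pi.single i 1) * T x i)) := fun i => (hib i).1.neg
  have s2 : ∫ x, (1 / 4) * ∑ i, |u x| ^ 3 * D x i =
      ∫ x, (1 / 4) * ∑ i, -(3 * u x * |u x| * fderiv ℝ u x (Pi.single i 1) * T x i) := by
    rw [integral_const_mul, integral_const_mul, integral_finsetSum _ fun i _ => (hib i).2.1,
      integral_finsetSum _ fun i _ => hneg i]
    congr 1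
    refine Finset.sum_congr rfl fun i _ => ?_
    rw [(hib i).2.2, integral_neg]
  have s3 : ∫ x, (1 / 4) * ∑ i, -(3 * u x * |u x| * fderiv ℝ u x (Pi.single i 1) * T x i) ≤
      ∫ x, ((3 / 2) * ∑ i, (fderiv ℝ u x (Pi.single i 1)) ^ 2
        + (3 / 32) * ((∑ i, T x i ^ 2) * u x ^ 4)) := by
    refine integral_mono ((integrable_finsetSum _ fun i _ => hneg i).const_mul _)
      (((integrable_finsetSum _ fun i _ => hp i).const_mul _).add ((hInteg _ hsq).const_mul _))
      fun x => ?_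
    simp only
    rw [Finset.sum_mul, Finset.mul_sum, Finset.mul_sum, Finset.mul_sum, ← Finset.sum_add_distrib]
    refine Finset.sum_le_sum fun i _ => ?_
    have e4 : u x ^ 4 = (u x * |u x|) ^ 2 := by
      rw [mul_pow, sq_abs]; ring
    rw [e4]
    nlinarith [sq_nonneg (4 * fderiv ℝ u x (Pi.single i 1) + u x * |u x| * T x i)]
  rw [integral_add ((integrable_finsetSum _ fun i _ => hp i).const_mul _)
    ((hInteg _ hsq).const_mul _), integral_const_mul (3/2 : ℝ), integral_const_mul (3/32 : ℝ)] at s3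
  linarith


/-- The Euclidean space `ℝ⁴`. -/
abbrev E4 := EuclideanSpace ℝ (Fin 4)

lemma hasDerivAt_q (y : ℝ) : HasDerivAt (fun y : ℝ => (1 + y ^ 2 / 8)⁻¹)
    (-(y / 4) * ((1 + y ^ 2 / 8)⁻¹) ^ 2) y := by
  have h0 : (1 + y ^ 2 / 8) ≠ 0 := by positivity
  have h := ((((hasDerivAt_id y).pow 2).div_const 8).const_add 1).inv (by simpa using h0)
  refine h.congr_deriv ?_
  have e : (id ^ 2 : ℝ → ℝ) y = y ^ 2 := rfl
  simp only [e, id]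
  field_simp
  norm_num
  ring

lemma tendsto_q : Filter.Tendsto (fun y : ℝ => (1 + y ^ 2 / 8)⁻¹) Filter.atTop (nhds 0) := by
  apply Filter.Tendsto.inv_tendsto_atTop
  apply Filter.tendsto_atTop_add_const_left
  exact (Filter.tendsto_pow_atTop two_ne_zero).atTop_div_const (by norm_num)

lemma rad1 : IntegrableOn (fun y : ℝ => y ^ 3 * ((1 + y ^ 2 / 8)⁻¹) ^ 4) (Set.Ioi 0) ∧
    ∫ y in Set.Ioi (0:ℝ), y ^ 3 * ((1 + y ^ 2 / 8)⁻¹) ^ 4 = 16 / 3 := by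
  have hd : ∀ y ∈ Set.Ici (0:ℝ), HasDerivAt (fun y : ℝ => 32 * (1 / 6 - ((1 + y ^ 2 / 8)⁻¹) ^ 2 / 2
      + ((1 + y ^ 2 / 8)⁻¹) ^ 3 / 3)) (y ^ 3 * ((1 + y ^ 2 / 8)⁻¹) ^ 4) y := by
    intro y _
    have hq := hasDerivAt_q y
    have h := (((((hq.pow 2).div_const 2).const_sub (1/6))).add ((hq.pow 3).div_const 3)).const_mul 32
    have h0 : (1 + y ^ 2 / 8) ≠ 0 := by positivity
    refine h.congr_deriv ?_
    norm_num
    field_simp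
    ring
  have hpos : ∀ y ∈ Set.Ioi (0:ℝ), 0 ≤ y ^ 3 * ((1 + y ^ 2 / 8)⁻¹) ^ 4 := fun y hy => by
    have : (0:ℝ) < y := hy
    positivity
  have ht : Filter.Tendsto (fun y : ℝ => 32 * (1 / 6 - ((1 + y ^ 2 / 8)⁻¹) ^ 2 / 2
      + ((1 + y ^ 2 / 8)⁻¹) ^ 3 / 3)) Filter.atTop (nhds (32 * (1 / 6 - 0 ^ 2 / 2 + 0 ^ 3 / 3))) :=
    ((((tendsto_q.pow 2).div_const 2).const_sub _).add ((tendsto_q.pow 3).div_const 3)).const_mul _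
  refine ⟨integrableOn_Ioi_deriv_of_nonneg' hd hpos ht, ?_⟩
  rw [integral_Ioi_of_hasDerivAt_of_nonneg' hd hpos ht]
  norm_num

lemma rad2 : IntegrableOn (fun y : ℝ => y ^ 3 * (y ^ 2 * ((1 + y ^ 2 / 8)⁻¹) ^ 4)) (Set.Ioi 0) ∧
    ∫ y in Set.Ioi (0:ℝ), y ^ 3 * (y ^ 2 * ((1 + y ^ 2 / 8)⁻¹) ^ 4) = 256 / 3 := by
  have hd : ∀ y ∈ Set.Ici (0:ℝ), HasDerivAt (fun y : ℝ => 256 / 3 * (1 - (1 + y ^ 2 / 8)⁻¹) ^ 3)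
      (y ^ 3 * (y ^ 2 * ((1 + y ^ 2 / 8)⁻¹) ^ 4)) y := by
    intro y _
    have hq := hasDerivAt_q y
    have h := ((hq.const_sub 1).pow 3).const_mul (256 / 3)
    have h0 : (1 + y ^ 2 / 8) ≠ 0 := by positivity
    refine h.congr_deriv ?_
    norm_num
    field_simp
    ring
  have hpos : ∀ y ∈ Set.Ioi (0:ℝ), 0 ≤ y ^ 3 * (y ^ 2 * ((1 + y ^ 2 / 8)⁻¹) ^ 4) := fun y hy => by
    have : (0:ℝ) < y := hy
    positivity
  have ht : Filter.Tendsto (fun y : ℝ => 256 / 3 * (1 - (1 + y ^ 2 / 8)⁻¹) ^ 3)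
      Filter.atTop (nhds (256 / 3 * (1 - 0) ^ 3)) :=
    ((tendsto_q.const_sub 1).pow 3).const_mul _
  refine ⟨integrableOn_Ioi_deriv_of_nonneg' hd hpos ht, ?_⟩
  rw [integral_Ioi_of_hasDerivAt_of_nonneg' hd hpos ht]
  norm_num

lemma int_W4 : Integrable (fun x : E4 => ((1 + ‖x‖ ^ 2 / 8)⁻¹) ^ 4) := by
  rw [integrable_fun_norm_addHaar volume (f := fun y : ℝ => ((1 + y ^ 2 / 8)⁻¹) ^ 4)]
  simpa using rad1.1

lemma int_r2W4 : Integrable (fun x : E4 => ‖x‖ ^ 2 * ((1 + ‖x‖ ^ 2 / 8)⁻¹) ^ 4) := by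
  rw [integrable_fun_norm_addHaar volume (f := fun y : ℝ => y ^ 2 * ((1 + y ^ 2 / 8)⁻¹) ^ 4)]
  simpa using rad2.1

lemma val_ratio : ∫ x : E4, ‖x‖ ^ 2 * ((1 + ‖x‖ ^ 2 / 8)⁻¹) ^ 4 =
    16 * ∫ x : E4, ((1 + ‖x‖ ^ 2 / 8)⁻¹) ^ 4 := by
  rw [integral_fun_norm_addHaar volume (fun y : ℝ => y ^ 2 * ((1 + y ^ 2 / 8)⁻¹) ^ 4),
    integral_fun_norm_addHaar volume (fun y : ℝ => ((1 + y ^ 2 / 8)⁻¹) ^ 4)]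
  simp only [finrank_euclideanSpace, Fintype.card_fin, smul_eq_mul,
    nsmul_eq_mul, show 4 - 1 = 3 from rfl]
  rw [rad1.2, rad2.2]; ring

lemma val_pos : 0 < ∫ x : E4, ((1 + ‖x‖ ^ 2 / 8)⁻¹) ^ 4 := by
  rw [integral_fun_norm_addHaar volume (fun y : ℝ => ((1 + y ^ 2 / 8)⁻¹) ^ 4)]
  simp only [finrank_euclideanSpace, Fintype.card_fin, smul_eq_mul,
    nsmul_eq_mul, show 4 - 1 = 3 from rfl]
  rw [rad1.2]
  have : 0 < (volume : Measure E4).real (Metric.ball 0 1) :=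
    ENNReal.toReal_pos (Metric.measure_ball_pos _ _ one_pos).ne' measure_ball_lt_top.ne
  positivity

lemma w_eq (x : Fin 4 → ℝ) : w x = (1 + ‖(WithLp.toLp 2 x : E4)‖ ^ 2 / 8)⁻¹ := by
  rw [EuclideanSpace.norm_sq_eq]; simp [w]

lemma integral_toLp (k : E4 → ℝ) : ∫ x : Fin 4 → ℝ, k (WithLp.toLp 2 x) = ∫ x, k x :=
  (PiLp.volume_preserving_toLp (Fin 4)).integral_comp
    (MeasurableEquiv.toLp 2 (Fin 4 → ℝ)).measurableEmbedding k

lemma integrable_toLp (k : E4 → ℝ) :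
    Integrable (fun x : Fin 4 → ℝ => k (WithLp.toLp 2 x)) ↔ Integrable k :=
  (PiLp.volume_preserving_toLp (Fin 4)).integrable_comp_emb
    (MeasurableEquiv.toLp 2 (Fin 4 → ℝ)).measurableEmbedding

lemma w_facts : Integrable (fun x => w x ^ 4) ∧ Integrable (fun x => (∑ i, x i ^ 2) * w x ^ 4) ∧
    Integrable (fun x => w x ^ 3) ∧ 0 < ∫ x, w x ^ 4 ∧
    ∫ x, (∑ i, x i ^ 2) * w x ^ 4 = 16 * ∫ x, w x ^ 4 ∧
    ∫ x, w x ^ 3 = 3 * ∫ x, w x ^ 4 := by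
  have e1 : (fun x => w x ^ 4) =
      fun x => (fun z : E4 => ((1 + ‖z‖ ^ 2 / 8)⁻¹) ^ 4) (WithLp.toLp 2 x) := by
    funext x; rw [w_eq]
  have e2 : (fun x => (∑ i, x i ^ 2) * w x ^ 4) =
      fun x => (fun z : E4 => ‖z‖ ^ 2 * ((1 + ‖z‖ ^ 2 / 8)⁻¹) ^ 4) (WithLp.toLp 2 x) := by
    funext x; rw [w_eq]; simp only [EuclideanSpace.norm_sq_eq]; simp
  have i1 : Integrable (fun x => w x ^ 4) := by rw [e1]; exact (integrable_toLp _).2 int_W4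
  have i2 : Integrable (fun x => (∑ i, x i ^ 2) * w x ^ 4) := by
    rw [e2]; exact (integrable_toLp _).2 int_r2W4
  have e3 : (fun x => w x ^ 3) = fun x => w x ^ 4 + (1 / 8) * ((∑ i, x i ^ 2) * w x ^ 4) := by
    funext x
    have h := (w_den_pos x).ne'
    have : w x ^ 3 = w x ^ 4 * (1 + (∑ i, x i ^ 2) / 8) := by
      unfold w; field_simp
    rw [this]; ring
  have v2 : ∫ x, (∑ i, x i ^ 2) * w x ^ 4 = 16 * ∫ x, w x ^ 4 := by
    rw [e1, e2]; exact (integral_toLp _).trans (val_ratio.trans (congrArg _ (integral_toLp _).symm))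
  refine ⟨i1, i2, ?_, ?_, v2, ?_⟩
  · rw [e3]; exact i1.add (i2.const_mul _)
  · rw [e1]; exact val_pos.trans_eq (integral_toLp _).symm
  · rw [e3, integral_add i1 (i2.const_mul _), integral_const_mul, v2]; ring

lemma tendsto_Q {k : (Fin 4 → ℝ) → ℝ} (hk : Integrable k) :
    Filter.Tendsto (fun N : ℕ => ∫ x in Q 4 ((N : ℝ) + 1), k x) Filter.atTop (nhds (∫ x, k x)) := by
  have hU : ⋃ N : ℕ, Q 4 ((N : ℝ) + 1) = Set.univ := by
    refine Set.eq_univ_of_forall fun x => Set.mem_iUnion.2 ?_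
    obtain ⟨N, hN⟩ := exists_nat_ge (∑ i, |x i|)
    refine ⟨N, fun i => ?_⟩
    have := Finset.single_le_sum (f := fun i => |x i|) (fun i _ => abs_nonneg _) (Finset.mem_univ i)
    have h2 : |x i| ≤ ∑ i, |x i| := this
    linarith
  have h := tendsto_setIntegral_of_monotone (μ := volume) (f := k)
    (s := fun N : ℕ => Q 4 ((N : ℝ) + 1)) (fun N => measurableSet_Q _ _)
    (fun a b hab x hx i => (hx i).trans (by have : (a : ℝ) ≤ b := by exact_mod_cast hab
                                            linarith)) hk.integrableOn
  rwa [hU, setIntegral_univ] at h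

lemma sob_fin {u : (Fin 4 → ℝ) → ℝ} (hu : Differentiable ℝ u) {M : ℝ} (hM : 0 < M)
    (hsupp : ∀ x, u x ≠ 0 → ∀ i, |x i| < M)
    (hp : ∀ i, Integrable (fun x => (fderiv ℝ u x (Pi.single i 1)) ^ 2)) :
    (∫ x, w x ^ 4) * ∫ x, u x ^ 4 ≤ (∫ x, ∑ i, (fderiv ℝ u x (Pi.single i 1)) ^ 2) ^ 2 := by
  obtain ⟨i4, i2, i3, hA, v2, v3⟩ := w_facts
  set A := ∫ x, w x ^ 4
  set U := ∫ x, u x ^ 4 with hU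
  set N := ∫ x, ∑ i, (fderiv ℝ u x (Pi.single i 1)) ^ 2 with hN
  have hU0 : 0 ≤ U := integral_nonneg fun x => by positivity
  rcases hU0.eq_or_lt with h0 | hUpos
  · rw [← h0, mul_zero]; positivity
  have step : ∀ n : ℕ, ∫ x in Q 4 ((n : ℝ) + 1), w x ^ 3 ≤
      (3 / 2) * (√((∫ x in Q 4 ((n : ℝ) + 1), w x ^ 4) / U) * N)
      + (3 / 32) * ∫ x in Q 4 ((n : ℝ) + 1), (∑ i, x i ^ 2) * w x ^ 4 := by
    intro n
    set An := ∫ x in Q 4 ((n : ℝ) + 1), w x ^ 4 with hAn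
    have hAn0 : 0 ≤ An := integral_nonneg fun x => by positivity
    set c := √(√(An / U)) with hc
    have hc2 : c ^ 2 = √(An / U) := Real.sq_sqrt (Real.sqrt_nonneg _)
    have hc4 : c ^ 4 = An / U := by
      rw [show c ^ 4 = (c ^ 2) ^ 2 by ring, hc2, Real.sq_sqrt (by positivity)]
    have hfd : ∀ x, fderiv ℝ (fun x => c * u x) x = c • fderiv ℝ u x := fun x =>
      fderiv_const_mul (hu x) c
    have hpc : ∀ x i, (fderiv ℝ (fun x => c * u x) x (Pi.single i 1)) ^ 2 =
        c ^ 2 * (fderiv ℝ u x (Pi.single i 1)) ^ 2 := fun x i => by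
      rw [hfd]; simp [mul_pow]
    have := key (u := fun x => c * u x) (hu.const_mul c) hM (by positivity : (0:ℝ) < n + 1)
      (fun x hx => hsupp x (right_ne_zero_of_mul hx))
      (fun i => by simp only [hpc]; exact (hp i).const_mul _)
      (by simp only [mul_pow]; rw [integral_const_mul, hc4, ← hU]; field_simp; rfl)
    simp only [hpc, ← Finset.mul_sum] at this
    rwa [integral_const_mul, hc2] at this
  have hlim := le_of_tendsto_of_tendsto' (tendsto_Q i3)
    ((((((tendsto_Q i4).div_const U).sqrt).mul_const N).const_mul (3/2)).add
      ((tendsto_Q i2).const_mul (3/32))) step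
  rw [v3, v2] at hlim
  have h1 : A ≤ √(A / U) * N := by
    change 3 * A ≤ 3 / 2 * (√(A / U) * N) + 3 / 32 * (16 * A) at hlim
    linarith
  have h2 : A ^ 2 ≤ (√(A / U) * N) ^ 2 := pow_le_pow_left₀ hA.le h1 2
  rw [mul_pow, Real.sq_sqrt (by positivity), div_mul_eq_mul_div, le_div_iff₀ hUpos] at h2
  have h3 : A * (A * U) ≤ A * N ^ 2 := by nlinarith
  exact le_of_mul_le_mul_left h3 hA


lemma norm_sq_functional (L : E4 →L[ℝ] ℝ) :
    ∑ i, (L (WithLp.toLp 2 (Pi.single i 1))) ^ 2 = ‖L‖ ^ 2 := by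
  rw [← LinearIsometryEquiv.norm_map (InnerProductSpace.toDual ℝ E4).symm L,
    EuclideanSpace.norm_sq_eq]
  refine Finset.sum_congr rfl fun i _ => ?_
  rw [← InnerProductSpace.toDual_symm_apply (x := WithLp.toLp 2 (Pi.single i 1)) (y := L)]
  rw [Real.norm_eq_abs, sq_abs]
  congr 1
  change inner ℝ _ (EuclideanSpace.single i (1 : ℝ)) = _
  rw [EuclideanSpace.inner_single_right]
  simp

lemma sob_E4 {u : E4 → ℝ} (hu : Differentiable ℝ u) {M : ℝ} (hM : 0 < M)
    (hsupp : ∀ x, u x ≠ 0 → ‖x‖ < M)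
    (hp : Integrable (fun x => ‖fderiv ℝ u x‖ ^ 2)) :
    (∫ x : E4, ((1 + ‖x‖ ^ 2 / 8)⁻¹) ^ 4) * ∫ x, u x ^ 4 ≤ (∫ x, ‖fderiv ℝ u x‖ ^ 2) ^ 2 := by
  let e : (Fin 4 → ℝ) →L[ℝ] E4 := ((PiLp.continuousLinearEquiv 2 ℝ (fun _ : Fin 4 => ℝ)).symm :
    (Fin 4 → ℝ) →L[ℝ] E4)
  have he : ∀ x, e x = WithLp.toLp 2 x := fun x => rfl
  have hd : ∀ x y, fderiv ℝ (fun x => u (e x)) x y = fderiv ℝ u (WithLp.toLp 2 x) (WithLp.toLp 2 y) := by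
    intro x y
    have h := (hu (e x)).hasFDerivAt.comp x e.hasFDerivAt
    have h2 : fderiv ℝ (fun x => u (e x)) x = (fderiv ℝ u (e x)).comp e := h.fderiv
    rw [h2]; rfl
  have hi : ∀ i : Fin 4, Integrable (fun x : E4 =>
      (fderiv ℝ u x (WithLp.toLp 2 (Pi.single i 1))) ^ 2) := fun i => by
    refine hp.mono' ((measurable_fderiv_apply_const ℝ u _).pow_const 2).aestronglyMeasurable ?_
    refine Filter.Eventually.of_forall fun x => ?_
    rw [← norm_sq_functional, Real.norm_eq_abs, abs_of_nonneg (sq_nonneg _)]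
    exact Finset.single_le_sum
      (f := fun i => (fderiv ℝ u x (WithLp.toLp 2 (Pi.single i 1))) ^ 2)
      (fun i _ => sq_nonneg _) (Finset.mem_univ i)
  have h := sob_fin (u := fun x => u (e x)) (hu.comp e.differentiable) hM
    (fun x hx i => lt_of_le_of_lt (by simpa [he] using PiLp.norm_apply_le (e x) i) (hsupp _ hx))
    (fun i => by simp only [hd]; exact (integrable_toLp _).2 (hi i))
  simp only [hd, norm_sq_functional, w_eq] at h
  simp only [he] at h
  have e1 := integral_toLp (fun x : E4 => ((1 + ‖x‖ ^ 2 / 8)⁻¹) ^ 4)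
  have e2 := integral_toLp (fun x : E4 => u x ^ 4)
  have e3 := integral_toLp (fun x : E4 => ‖fderiv ℝ u x‖ ^ 2)
  rw [← e1, ← e2, ← e3]
  exact h

lemma cutoff_bump : ∃ (φ : E4 → ℝ) (K : ℝ), 0 ≤ K ∧ Differentiable ℝ φ ∧ (∀ x, 0 ≤ φ x) ∧
    (∀ x, φ x ≤ 1) ∧ (∀ x, ‖x‖ < 1 → φ x = 1) ∧ (∀ x, φ x ≠ 0 → ‖x‖ < 2) ∧
    (∀ x, ‖fderiv ℝ φ x‖ ≤ K) ∧ ∀ x, fderiv ℝ φ x ≠ 0 → 1 ≤ ‖x‖ ∧ ‖x‖ ≤ 2 := by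
  let f : ContDiffBump (0 : E4) := ⟨1, 2, one_pos, by norm_num⟩
  have hcd : ContDiff ℝ 1 f := f.contDiff
  obtain ⟨K, hK⟩ := (hcd.continuous_fderiv one_ne_zero).bounded_above_of_compact_support
    (f.hasCompactSupport.fderiv (𝕜 := ℝ))
  refine ⟨f, K, (norm_nonneg _).trans (hK 0), hcd.differentiable one_ne_zero, fun x => f.nonneg,
    fun x => f.le_one, fun x hx => f.one_of_mem_closedBall (by simpa [f] using hx.le), ?_, hK, ?_⟩
  · intro x hx
    have : x ∈ Function.support f := hx
    rw [f.support_eq] at this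
    simpa [f] using this
  · intro x hx
    constructor
    · by_contra! hlt
      have := f.eventuallyEq_one_of_mem_ball (x := x) (by simpa [f] using hlt)
      apply hx
      rw [this.fderiv_eq]
      simp
    · have : x ∈ tsupport f := support_fderiv_subset ℝ hx
      rw [f.tsupport_eq] at this
      simpa [f] using this

lemma sob_cut {u : E4 → ℝ} (hu : Differentiable ℝ u)
    (hgrad : Integrable (fun x => ‖fderiv ℝ u x‖ ^ 2)) (hL4 : Integrable (fun x => u x ^ 4)) :
    ∃ C : ℝ, ∀ ε : ℝ, 0 < ε → ∀ l : ℝ, 0 < l → ∀ R : ℝ, 0 < R →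
    (∫ x : E4, ((1 + ‖x‖ ^ 2 / 8)⁻¹) ^ 4) * ((∫ x, u x ^ 4) - ∫ x in {x | R ≤ ‖x‖}, u x ^ 4) ≤
      ((1 + ε) * (∫ x, ‖fderiv ℝ u x‖ ^ 2) + (1 + ε⁻¹) * (C * l +
        C * l⁻¹ * ∫ x in {x | R ≤ ‖x‖}, u x ^ 4)) ^ 2 := by
  obtain ⟨φ, K, hK0, hφd, hφ0, hφ1, hφone, hφs, hφK, hφ'⟩ := cutoff_bump
  set V := (volume : Measure E4).real (Metric.ball 0 1) with hV
  have hV0 : 0 ≤ V := measureReal_nonneg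
  refine ⟨K ^ 2 / 2 * (1 + 16 * V), fun ε hε l hl R hR => ?_⟩
  set S : Set E4 := {x | R ≤ ‖x‖} with hS
  have hSm : MeasurableSet S := measurableSet_le measurable_const measurable_norm
  set B : Set E4 := Metric.closedBall 0 (2 * R) with hB
  have hBm : MeasurableSet B := Metric.isClosed_closedBall.measurableSet
  set T := ∫ x in S, u x ^ 4 with hT
  have hT0 : 0 ≤ T := integral_nonneg fun x => by positivity
  let c := R⁻¹
  have hc : 0 < c := inv_pos.2 hR
  let v : E4 → ℝ := fun x => φ (c • x) * u x
  have hχ : ∀ x, HasFDerivAt (fun x : E4 => φ (c • x)) (c • fderiv ℝ φ (c • x)) x := fun x => by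
    have h1 : HasFDerivAt (fun x : E4 => c • x) (c • ContinuousLinearMap.id ℝ E4) x :=
      (hasFDerivAt_id x).const_smul c
    have h2 := (hφd (c • x)).hasFDerivAt.comp x h1
    refine h2.congr_fderiv ?_
    ext y; simp
  have hv : ∀ x, HasFDerivAt v (φ (c • x) • fderiv ℝ u x + u x • (c • fderiv ℝ φ (c • x))) x :=
    fun x => (hχ x).mul (hu x).hasFDerivAt
  have hvd : Differentiable ℝ v := fun x => (hv x).differentiableAt
  have hnc : ∀ x : E4, ‖c • x‖ = ‖x‖ / R := fun x => by
    rw [norm_smul, Real.norm_eq_abs, abs_of_pos hc, div_eq_inv_mul]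
  have hvs : ∀ x, v x ≠ 0 → ‖x‖ < 2 * R := fun x hx => by
    have := hφs _ (left_ne_zero_of_mul hx)
    rwa [hnc, div_lt_iff₀ hR] at this
  let g : E4 → ℝ := fun x => (1 + ε) * ‖fderiv ℝ u x‖ ^ 2 + (1 + ε⁻¹) *
    (B.indicator (fun _ => K ^ 2 / 2 * l * c ^ 4) x +
      K ^ 2 / 2 * l⁻¹ * S.indicator (fun x => u x ^ 4) x)
  have hpt : ∀ x, ‖fderiv ℝ v x‖ ^ 2 ≤ g x := fun x => by
    have hn : ‖fderiv ℝ v x‖ ≤ ‖fderiv ℝ u x‖ + |u x| * (c * ‖fderiv ℝ φ (c • x)‖) := by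
      rw [(hv x).fderiv]
      refine (norm_add_le _ _).trans ?_
      rw [norm_smul, norm_smul, norm_smul, Real.norm_eq_abs, Real.norm_eq_abs, Real.norm_eq_abs,
        abs_of_pos hc, abs_of_nonneg (hφ0 _)]
      gcongr
      exact mul_le_of_le_one_left (norm_nonneg _) (hφ1 _)
    set a := ‖fderiv ℝ u x‖
    set b := |u x| * (c * ‖fderiv ℝ φ (c • x)‖) with hb
    have hb2 : b ^ 2 ≤ B.indicator (fun _ => K ^ 2 / 2 * l * c ^ 4) x +
      K ^ 2 / 2 * l⁻¹ * S.indicator (fun x => u x ^ 4) x := by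
      by_cases h0 : fderiv ℝ φ (c • x) = 0
      · rw [hb, h0]
        have h1 : 0 ≤ B.indicator (fun _ => K ^ 2 / 2 * l * c ^ 4) x :=
          Set.indicator_nonneg (fun _ _ => by positivity) x
        have h2 : 0 ≤ S.indicator (fun x => u x ^ 4) x :=
          Set.indicator_nonneg (fun _ _ => by positivity) x
        have h3 : 0 ≤ K ^ 2 / 2 * l⁻¹ * S.indicator (fun x => u x ^ 4) x :=
          mul_nonneg (by positivity) h2
        rw [norm_zero, mul_zero, mul_zero, zero_pow two_ne_zero]
        exact add_nonneg h1 h3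
      · obtain ⟨h1, h2⟩ := hφ' _ h0
        rw [hnc, le_div_iff₀ hR, one_mul] at h1
        rw [hnc, div_le_iff₀ hR] at h2
        rw [Set.indicator_of_mem (show x ∈ B by simpa [hB] using h2),
          Set.indicator_of_mem (show x ∈ S from h1)]
        have h3 : b ^ 2 ≤ (|u x| * (c * K)) ^ 2 := by
          rw [hb]; gcongr; exact hφK _
        have h4 : (|u x| * (c * K)) ^ 2 = K ^ 2 / 2 * (2 * c ^ 2 * u x ^ 2) := by
          rw [mul_pow, sq_abs]; ring
        have h5 : 2 * c ^ 2 * u x ^ 2 ≤ l * c ^ 4 + l⁻¹ * u x ^ 4 := by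
          have : 0 ≤ l⁻¹ * (l * c ^ 2 - u x ^ 2) ^ 2 := by positivity
          have e : l⁻¹ * (l * c ^ 2 - u x ^ 2) ^ 2 =
            l * c ^ 4 + l⁻¹ * u x ^ 4 - 2 * c ^ 2 * u x ^ 2 := by field_simp; ring
          linarith
        have h6 := mul_le_mul_of_nonneg_left h5 (show 0 ≤ K ^ 2 / 2 by positivity)
        linarith
    have h7 : ‖fderiv ℝ v x‖ ^ 2 ≤ (a + b) ^ 2 := by gcongr
    have h8 : (a + b) ^ 2 ≤ (1 + ε) * a ^ 2 + (1 + ε⁻¹) * b ^ 2 := by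
      have : 0 ≤ ε⁻¹ * (ε * a - b) ^ 2 := by positivity
      have e : ε⁻¹ * (ε * a - b) ^ 2 = ε * a ^ 2 + ε⁻¹ * b ^ 2 - 2 * a * b := by
        field_simp
        ring
      linarith
    have h9 := mul_le_mul_of_nonneg_left hb2 (show 0 ≤ 1 + ε⁻¹ by positivity)
    change _ ≤ (1 + ε) * a ^ 2 + (1 + ε⁻¹) * _
    linarith
  have hBi : Integrable (B.indicator (fun _ : E4 => K ^ 2 / 2 * l * c ^ 4)) :=
    (integrable_indicator_iff hBm).2 (integrableOn_const measure_closedBall_lt_top.ne)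
  have hSi : Integrable (S.indicator (fun x => u x ^ 4)) := hL4.indicator hSm
  have hgi : Integrable g :=
    (hgrad.const_mul _).add ((hBi.add (hSi.const_mul _)).const_mul _)
  have hvi : Integrable (fun x => ‖fderiv ℝ v x‖ ^ 2) := by
    refine hgi.mono' ((measurable_fderiv ℝ v).norm.pow_const 2).aestronglyMeasurable ?_
    refine Filter.Eventually.of_forall fun x => ?_
    rw [Real.norm_eq_abs, abs_of_nonneg (sq_nonneg _)]
    exact hpt x
  have hgv : ∫ x, g x = (1 + ε) * (∫ x, ‖fderiv ℝ u x‖ ^ 2) + (1 + ε⁻¹) *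
      (K ^ 2 / 2 * (16 * V) * l + K ^ 2 / 2 * l⁻¹ * T) := by
    change ∫ x, ((1 + ε) * ‖fderiv ℝ u x‖ ^ 2 + (1 + ε⁻¹) *
      (B.indicator (fun _ => K ^ 2 / 2 * l * c ^ 4) x +
      K ^ 2 / 2 * l⁻¹ * S.indicator (fun x => u x ^ 4) x)) = _
    have hBS : Integrable (fun x => B.indicator (fun _ => K ^ 2 / 2 * l * c ^ 4) x +
      K ^ 2 / 2 * l⁻¹ * S.indicator (fun x => u x ^ 4) x) := hBi.add (hSi.const_mul _)
    rw [integral_add (hgrad.const_mul _) (hBS.const_mul _),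
      integral_const_mul, integral_const_mul, integral_add hBi (hSi.const_mul _),
      integral_const_mul, integral_indicator hSm, integral_indicator hBm, setIntegral_const,
      hB, Measure.addHaar_real_closedBall _ _ (by positivity), ← hV]
    simp only [finrank_euclideanSpace, Fintype.card_fin, smul_eq_mul]
    have : (2 * R) ^ 4 * V * (K ^ 2 / 2 * l * c ^ 4) = K ^ 2 / 2 * (16 * V) * l := by
      simp only [c]; field_simp; ring
    rw [this]
  have hmain := sob_E4 hvd (by positivity : 0 < 2 * R) hvs hvi
  have hv4i : Integrable (fun x => v x ^ 4) := by
    refine hL4.mono' (hvd.continuous.pow 4).aestronglyMeasurable ?_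
    refine Filter.Eventually.of_forall fun x => ?_
    rw [Real.norm_eq_abs, abs_of_nonneg (by positivity), mul_pow]
    exact mul_le_of_le_one_left (by positivity) (pow_le_one₀ (hφ0 _) (hφ1 _))
  have hlow : (∫ x, u x ^ 4) - T ≤ ∫ x, v x ^ 4 := by
    rw [hT, ← integral_indicator hSm, ← integral_sub hL4 hSi]
    refine integral_mono (hL4.sub hSi) hv4i fun x => ?_
    simp only
    by_cases hx : x ∈ S
    · rw [Set.indicator_of_mem hx, sub_self]; positivity
    · rw [Set.indicator_of_notMem hx, sub_zero]
      have h1 : ‖x‖ < R := not_le.1 hx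
      have : φ (c • x) = 1 := hφone _ (by rw [hnc, div_lt_one hR]; exact h1)
      simp [v, this]
  have hN : ∫ x, ‖fderiv ℝ v x‖ ^ 2 ≤ (1 + ε) * (∫ x, ‖fderiv ℝ u x‖ ^ 2) + (1 + ε⁻¹) *
      (K ^ 2 / 2 * (1 + 16 * V) * l + K ^ 2 / 2 * (1 + 16 * V) * l⁻¹ * T) := by
    refine ((integral_mono hvi hgi hpt).trans_eq hgv).trans ?_
    have h1 : 16 * V ≤ 1 + 16 * V := by linarith
    have h2 : K ^ 2 / 2 ≤ K ^ 2 / 2 * (1 + 16 * V) :=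
      le_mul_of_one_le_right (by positivity) (by linarith)
    gcongr
  calc _ ≤ (∫ x : E4, ((1 + ‖x‖ ^ 2 / 8)⁻¹) ^ 4) * ∫ x, v x ^ 4 :=
        mul_le_mul_of_nonneg_left hlow val_pos.le
    _ ≤ _ := hmain
    _ ≤ _ := pow_le_pow_left₀ (integral_nonneg fun x => by positivity) hN 2

lemma sobolev {u : E4 → ℝ} (hu : Differentiable ℝ u)
    (hgrad : Integrable (fun x => ‖fderiv ℝ u x‖ ^ 2)) (hL4 : Integrable (fun x => u x ^ 4)) :
    (∫ x : E4, ((1 + ‖x‖ ^ 2 / 8)⁻¹) ^ 4) * (∫ x, u x ^ 4) ≤ (∫ x, ‖fderiv ℝ u x‖ ^ 2) ^ 2 := by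
  obtain ⟨C, hC⟩ := sob_cut hu hgrad hL4
  set A := ∫ x : E4, ((1 + ‖x‖ ^ 2 / 8)⁻¹) ^ 4
  set N := ∫ x, ‖fderiv ℝ u x‖ ^ 2
  set U := ∫ x, u x ^ 4
  have hT : Filter.Tendsto (fun n : ℕ => ∫ x in {x : E4 | (n : ℝ) + 1 ≤ ‖x‖}, u x ^ 4)
      Filter.atTop (nhds 0) := by
    have h := tendsto_setIntegral_of_antitone (μ := volume) (f := fun x => u x ^ 4)
      (s := fun n : ℕ => {x : E4 | (n : ℝ) + 1 ≤ ‖x‖})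
      (fun n => measurableSet_le measurable_const measurable_norm)
      (fun a b hab x hx => by
        have : (a : ℝ) ≤ b := by exact_mod_cast hab
        have hx' : (b : ℝ) + 1 ≤ ‖x‖ := hx
        change (a : ℝ) + 1 ≤ ‖x‖
        linarith) ⟨0, hL4.integrableOn⟩
    have he : ⋂ n : ℕ, {x : E4 | (n : ℝ) + 1 ≤ ‖x‖} = ∅ := by
      refine Set.eq_empty_of_forall_notMem fun x hx => ?_
      obtain ⟨n, hn⟩ := exists_nat_ge ‖x‖
      have h1 : (n : ℝ) + 1 ≤ ‖x‖ := Set.mem_iInter.1 hx n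
      linarith
    rwa [he, setIntegral_empty] at h
  have h1 : ∀ ε : ℝ, 0 < ε → A * U ≤ ((1 + ε) * N + C * (ε ^ 2 + ε)) ^ 2 := by
    intro ε hε
    have h := le_of_tendsto_of_tendsto' ((hT.const_sub U).const_mul A)
      (((((hT.const_mul (C * (ε ^ 2)⁻¹)).const_add (C * ε ^ 2)).const_mul (1 + ε⁻¹)).const_add
        ((1 + ε) * N)).pow 2) (fun n : ℕ => hC ε hε (ε ^ 2) (by positivity) ((n : ℝ) + 1)
          (by positivity))
    have e : (1 + ε⁻¹) * (C * ε ^ 2 + C * (ε ^ 2)⁻¹ * 0) = C * (ε ^ 2 + ε) := by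
      field_simp; ring
    rwa [e, sub_zero] at h
  have h2 : Filter.Tendsto (fun ε : ℝ => ((1 + ε) * N + C * (ε ^ 2 + ε)) ^ 2)
      (nhdsWithin 0 (Set.Ioi 0)) (nhds (N ^ 2)) := by
    have : Continuous (fun ε : ℝ => ((1 + ε) * N + C * (ε ^ 2 + ε)) ^ 2) := by fun_prop
    have h := this.tendsto 0
    norm_num at h
    exact h.mono_left nhdsWithin_le_nhds
  exact ge_of_tendsto h2 (Filter.eventually_of_mem self_mem_nhdsWithin fun ε hε => h1 ε hε)

lemma norm_fderiv_W (x : E4) :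
    ‖fderiv ℝ (fun x : E4 => (1 + ‖x‖ ^ 2 / 8)⁻¹) x‖ ^ 2 =
      (1 / 16) * (‖x‖ ^ 2 * ((1 + ‖x‖ ^ 2 / 8)⁻¹) ^ 4) := by
  have h0 : (1 + ‖x‖ ^ 2 / 8) ≠ 0 := by positivity
  have h1 : HasFDerivAt (fun x : E4 => ‖x‖ ^ 2) (2 • innerSL ℝ x) x :=
    (hasStrictFDerivAt_norm_sq x).hasFDerivAt
  have hd : HasDerivAt (fun t : ℝ => (1 + t / 8)⁻¹) (-(1 / 8) / (1 + ‖x‖ ^ 2 / 8) ^ 2) (‖x‖ ^ 2) :=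
    (((hasDerivAt_id (‖x‖ ^ 2)).div_const 8).const_add 1).inv h0
  have h2 := hd.comp_hasFDerivAt x h1
  have h3 : fderiv ℝ (fun x : E4 => (1 + ‖x‖ ^ 2 / 8)⁻¹) x = _ := h2.fderiv
  rw [h3, norm_smul, ← Nat.cast_smul_eq_nsmul ℝ, norm_smul, innerSL_apply_norm, mul_pow, mul_pow,
    Real.norm_eq_abs, Real.norm_eq_abs, sq_abs, sq_abs]
  field_simp
  norm_num
  ring

lemma int_grad_W : ∫ x : E4, ‖fderiv ℝ (fun x : E4 => (1 + ‖x‖ ^ 2 / 8)⁻¹) x‖ ^ 2 =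
    ∫ x : E4, ((1 + ‖x‖ ^ 2 / 8)⁻¹) ^ 4 := by
  simp only [norm_fderiv_W]
  rw [integral_const_mul, val_ratio]; ring

end Knothe

/-- Coercivity below the ground state: if `‖∇u‖² ≤ (1−δ̄)‖∇W‖²` then
`∫(|∇u|² − u⁴) ≥ δ̄ ∫|∇u|²`. -/
theorem coercivity_below_threshold (u : EuclideanSpace ℝ (Fin 4) → ℝ)
    (hu : Differentiable ℝ u)
    (hgrad : Integrable (fun x => ‖fderiv ℝ u x‖ ^ 2) volume)
    (hL4 : Integrable (fun x => (u x) ^ 4) volume)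
    (δbar : ℝ) (hδ : 0 < δbar)
    (hsmall : (∫ x, ‖fderiv ℝ u x‖ ^ 2) ≤
      (1 - δbar) * ∫ x : EuclideanSpace ℝ (Fin 4), ‖fderiv ℝ W x‖ ^ 2) :
    (∫ x, (‖fderiv ℝ u x‖ ^ 2 - (u x) ^ 4)) ≥ δbar * ∫ x, ‖fderiv ℝ u x‖ ^ 2 := by
  have hS : (∫ x : EuclideanSpace ℝ (Fin 4), ‖fderiv ℝ W x‖ ^ 2) =
      ∫ x : EuclideanSpace ℝ (Fin 4), ((1 + ‖x‖ ^ 2 / 8)⁻¹) ^ 4 := Knothe.int_grad_W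
  rw [hS] at hsmall
  have hA := Knothe.val_pos
  have hsob := Knothe.sobolev hu hgrad hL4
  rw [integral_sub hgrad hL4]
  have hN : 0 ≤ ∫ x, ‖fderiv ℝ u x‖ ^ 2 := integral_nonneg fun x => by positivity
  set A := ∫ x : EuclideanSpace ℝ (Fin 4), ((1 + ‖x‖ ^ 2 / 8)⁻¹) ^ 4
  set N := ∫ x, ‖fderiv ℝ u x‖ ^ 2
  set U := ∫ x, u x ^ 4
  have h1 : A * U ≤ A * ((1 - δbar) * N) := by
    have := mul_le_mul_of_nonneg_left hsmall hN
    nlinarith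
  have h2 := le_of_mul_le_mul_left h1 hA
  linarith
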